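/- Let Y_1, Y_2, Y'_1, Y'_2, W_1, W_2, W_3 be pairwise disjoint finite sets of indeterminates with |Y'_1| = |W_2| + |W_3|, |Y'_2| + |W_2| = |Y_2| + |W_1| and |Y_1| = |W_1| + |W_3|. Let P be the subalgebra of the polynomial ring over ℂ in all these variables consisting of polynomials that are separately symmetric in each of the seven alphabets, and let J be the ideal of P generated by {e_a(Y'_1) − e_a(W_2 ⊔ W_3) : a ≥ 1} ∪ {e_a(Y'_2 ⊔ W_2) − e_a(Y_2 ⊔ W_1) : a ≥ 1} ∪ {e_a(W_1 ⊔ W_3) − e_a(Y_1) : a ≥ 1}. Then the quotient B := P/J is a finitely generated module over the image in B of the subalgebra of P generated by the elementary symmetric polynomials e_a(Y_1), e_a(Y_2), e_a(Y'_1), e_a(Y'_2) (a ≥ 1) of the four boundary alphabets. (This is the content, for a single crossing, of the statement that the singular Soergel bimodule of a web appearing in the cube of resolutions of a braid diagram is finitely generated over the ring of symmetric functions in the boundary alphabets.) -/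

import Mathlib

open MvPolynomial

set_option synthInstance.maxHeartbeats 400000
set_option maxHeartbeats 1000000

noncomputable section

/-- The index type of the variables: `⟨l, j⟩` is the `j`-th variable of the `l`-th
alphabet `X_l`. -/
abbrev Idx {m : ℕ} (o : Fin m → ℕ) : Type := Σ l : Fin m, Fin (o l)

/-- The permutation of the variables induced by a family of permutations of the
individual alphabets. -/
def permIdx {m : ℕ} (o : Fin m → ℕ) (g : ∀ l, Equiv.Perm (Fin (o l))) : Idx o ≃ Idx o where
  toFun p := ⟨p.1, g p.1 p.2⟩
  invFun p := ⟨p.1, (g p.1).symm p.2⟩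
  left_inv p := by cases p; simp
  right_inv p := by cases p; simp

/-- The subalgebra of polynomials which are separately symmetric in each of the
alphabets `X_l`. -/
def sep {m : ℕ} (o : Fin m → ℕ) : Subalgebra ℂ (MvPolynomial (Idx o) ℂ) :=
  ⨅ g : ∀ l, Equiv.Perm (Fin (o l)),
    AlgHom.equalizer (rename ⇑(permIdx o g)) (AlgHom.id ℂ (MvPolynomial (Idx o) ℂ))

lemma mem_sep {m : ℕ} {o : Fin m → ℕ} {f : MvPolynomial (Idx o) ℂ} :
    f ∈ sep o ↔ ∀ g : ∀ l, Equiv.Perm (Fin (o l)), rename ⇑(permIdx o g) f = f := by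
  simp [sep, Algebra.mem_iInf, AlgHom.mem_equalizer]

/-- The finite set of variables belonging to the union of the alphabets `X_l`, `l ∈ s`. -/
def alphF {m : ℕ} (o : Fin m → ℕ) (s : Finset (Fin m)) : Finset (Idx o) :=
  Finset.univ.filter fun p => p.1 ∈ s

/-- The `j`-th elementary symmetric polynomial of the union of the alphabets `X_l`, `l ∈ s`. -/
def esymPoly {m : ℕ} (o : Fin m → ℕ) (s : Finset (Fin m)) (j : ℕ) :
    MvPolynomial (Idx o) ℂ :=
  ∑ t ∈ (alphF o s).powersetCard j, ∏ v ∈ t, X v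

lemma esymPoly_mem {m : ℕ} (o : Fin m → ℕ) (s : Finset (Fin m)) (j : ℕ) :
    esymPoly o s j ∈ sep o := by
  rw [mem_sep]
  intro g
  unfold esymPoly
  rw [map_sum]
  refine Finset.sum_nbij' (fun t => t.image (permIdx o g))
    (fun t => t.image (permIdx o g).symm) ?_ ?_ ?_ ?_ ?_
  · intro a ha
    rw [Finset.mem_powersetCard] at ha ⊢
    refine ⟨?_, ?_⟩
    · intro v hv
      rcases Finset.mem_image.mp hv with ⟨w, hw, rfl⟩
      have hw' := ha.1 hw
      simp only [alphF, Finset.mem_filter, Finset.mem_univ, true_and] at hw' ⊢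
      exact hw'
    · rw [Finset.card_image_of_injective _ (permIdx o g).injective]
      exact ha.2
  · intro a ha
    rw [Finset.mem_powersetCard] at ha ⊢
    refine ⟨?_, ?_⟩
    · intro v hv
      rcases Finset.mem_image.mp hv with ⟨w, hw, rfl⟩
      have hw' := ha.1 hw
      simp only [alphF, Finset.mem_filter, Finset.mem_univ, true_and] at hw' ⊢
      exact hw'
    · rw [Finset.card_image_of_injective _ (permIdx o g).symm.injective]
      exact ha.2
  · intro a _
    simp [Finset.image_image, Function.comp_def]
  · intro a _
    simp [Finset.image_image, Function.comp_def]
  · intro a _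
    rw [map_prod]
    simp only [rename_X]
    exact (Finset.prod_image fun x _ y _ hxy => (permIdx o g).injective hxy).symm

/-- The `j`-th elementary symmetric polynomial of `⊔_{l ∈ s} X_l` as an element of the
algebra of separately symmetric polynomials. -/
def Esub {m : ℕ} (o : Fin m → ℕ) (s : Finset (Fin m)) (j : ℕ) : sep o :=
  ⟨esymPoly o s j, esymPoly_mem o s j⟩

/-- The defining ideal `J` of the singular Soergel bimodule of the crossing web:
the alphabets are numbered `0 ↦ Y_1`, `1 ↦ Y_2`, `2 ↦ Y'_1`, `3 ↦ Y'_2`, `4 ↦ W_1`,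
`5 ↦ W_2`, `6 ↦ W_3`, and the generators identify the alphabets across each trivalent
vertex: `e_a(Y'_1) = e_a(W_2 ⊔ W_3)`, `e_a(Y'_2 ⊔ W_2) = e_a(Y_2 ⊔ W_1)` and
`e_a(W_1 ⊔ W_3) = e_a(Y_1)`, for all `a ≥ 1`. -/
def J12 (o : Fin 7 → ℕ) : Ideal (sep o) :=
  Ideal.span {f | ∃ a : ℕ, 1 ≤ a ∧
    (f = Esub o {2} a - Esub o {5, 6} a ∨
      f = Esub o {3, 5} a - Esub o {1, 4} a ∨
      f = Esub o {4, 6} a - Esub o {0} a)}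

/-- The generators `e_a(Y_1), e_a(Y_2), e_a(Y'_1), e_a(Y'_2)` (`a ≥ 1`) of the boundary
subalgebra. -/
def bdryGens (o : Fin 7 → ℕ) : Set (sep o) :=
  {x | ∃ i : Fin 7, (i = 0 ∨ i = 1 ∨ i = 2 ∨ i = 3) ∧ ∃ a : ℕ, 1 ≤ a ∧ x = Esub o {i} a}

/-- The polynomial `∑ j ≤ n, e j * X ^ (n - j)`, monic of degree `n` when `e 0 = 1`. -/
def descPoly {R : Type*} [CommRing R] (n : ℕ) (e : ℕ → R) : Polynomial R :=
  ∑ j ∈ Finset.range (n + 1), Polynomial.C (e j) * Polynomial.X ^ (n - j)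

lemma descPoly_map {R S : Type*} [CommRing R] [CommRing S] (f : R →+* S) (n : ℕ) (e : ℕ → R) :
    (descPoly n e).map f = descPoly n fun j => f (e j) := by
  simp [descPoly, Polynomial.map_sum]

lemma descPoly_coeff {R : Type*} [CommRing R] {n j : ℕ} (hj : j ≤ n) (e : ℕ → R) :
    (descPoly n e).coeff (n - j) = e j := by
  simp only [descPoly, Polynomial.finsetSum_coeff, Polynomial.coeff_C_mul_X_pow]
  rw [Finset.sum_eq_single j]
  · simp
  · intro i hi hij
    rw [Finset.mem_range] at hi
    exact if_neg (by omega)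
  · intro h
    exact absurd (Finset.mem_range.mpr (by omega)) h

lemma descPoly_monic {R : Type*} [CommRing R] (n : ℕ) {e : ℕ → R} (he : e 0 = 1) :
    (descPoly n e).Monic := by
  refine Polynomial.monic_of_natDegree_le_of_coeff_eq_one n ?_ ?_
  · exact Polynomial.natDegree_sum_le_of_forall_le _ _ fun j _ =>
      (Polynomial.natDegree_C_mul_X_pow_le _ _).trans (Nat.sub_le _ _)
  · simpa [he] using descPoly_coeff (Nat.zero_le n) e

lemma card_alphF {m : ℕ} (o : Fin m → ℕ) (s : Finset (Fin m)) :
    (alphF o s).card = ∑ l ∈ s, o l := by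
  have : alphF o s = s.sigma fun _ => Finset.univ := by
    ext p
    simp [alphF]
  rw [this, Finset.card_sigma]
  simp

lemma Esub_zero {m : ℕ} (o : Fin m → ℕ) (s : Finset (Fin m)) : Esub o s 0 = 1 :=
  Subtype.ext (by simp [Esub, esymPoly])

lemma Esub_eq_zero {m : ℕ} (o : Fin m → ℕ) (s : Finset (Fin m)) {j : ℕ}
    (hj : ∑ l ∈ s, o l < j) : Esub o s j = 0 :=
  Subtype.ext (by
    simp [Esub, esymPoly, Finset.powersetCard_eq_empty.mpr ((card_alphF o s).trans_lt hj)])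

/-- The monic polynomial whose roots are the negatives of the variables in `⊔_{l ∈ s} X_l`. -/
def alphPoly {m : ℕ} (o : Fin m → ℕ) (s : Finset (Fin m)) : Polynomial (sep o) :=
  descPoly (∑ l ∈ s, o l) (Esub o s)

lemma alphPoly_map_val {m : ℕ} (o : Fin m → ℕ) (s : Finset (Fin m)) :
    (alphPoly o s).map (algebraMap (sep o) (MvPolynomial (Idx o) ℂ)) =
      ∏ v ∈ alphF o s, (Polynomial.X + Polynomial.C (X v)) := by
  have h := Multiset.prod_X_add_C_eq_sum_esymm
    ((alphF o s).val.map (X : Idx o → MvPolynomial (Idx o) ℂ))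
  rw [Multiset.map_map, Multiset.card_map, Finset.card_val, card_alphF] at h
  refine Eq.trans ?_ h.symm
  rw [alphPoly, descPoly_map, descPoly]
  refine Finset.sum_congr rfl fun j _ => ?_
  rw [Finset.esymm_map_val]
  rfl

lemma alphPoly_union {m : ℕ} (o : Fin m → ℕ) {s t : Finset (Fin m)} (h : Disjoint s t) :
    alphPoly o (s ∪ t) = alphPoly o s * alphPoly o t := by
  apply Polynomial.map_injective (algebraMap (sep o) (MvPolynomial (Idx o) ℂ))
    Subtype.val_injective
  rw [Polynomial.map_mul]
  simp only [alphPoly_map_val]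
  rw [← Finset.prod_union]
  · congr 1
    ext p
    simp [alphF]
  · rw [Finset.disjoint_left] at h ⊢
    intro p hp
    simpa [alphF] using h (by simpa [alphF] using hp)

/-- The polynomial ring is integral over any subalgebra of the separately symmetric polynomials
containing the elementary symmetric polynomials of the individual alphabets. -/
lemma isIntegral_of_Esub_mem {m : ℕ} (o : Fin m → ℕ) (K : Subalgebra ℂ (sep o))
    (hK : ∀ l a, Esub o {l} a ∈ K) (f : MvPolynomial (Idx o) ℂ) : IsIntegral K f := by
  induction f using MvPolynomial.induction_on with
  | C c => exact isIntegral_algebraMap (R := K) (x := algebraMap ℂ K c)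
  | add p q hp hq => exact hp.add hq
  | mul_X p v hp =>
    refine hp.mul (IsIntegral.of_neg ?_)
    let P : Polynomial K := descPoly (R := K) (∑ l ∈ {v.1}, o l) fun a => ⟨Esub o {v.1} a, hK _ a⟩
    refine ⟨P, descPoly_monic _ (Subtype.ext (Esub_zero o _)), ?_⟩
    have hP : P.map (algebraMap K (MvPolynomial (Idx o) ℂ)) =
        ∏ w ∈ alphF o {v.1}, (Polynomial.X + Polynomial.C (X w)) := by
      rw [← alphPoly_map_val, alphPoly, descPoly_map]
      exact descPoly_map (R := K) (S := MvPolynomial (Idx o) ℂ) (algebraMap _ _) _ _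
    rw [← Polynomial.eval_map, hP, Polynomial.eval_prod]
    exact Finset.prod_eq_zero (i := v) (by simp [alphF]) (by simp)

lemma sep_finiteType {m : ℕ} (o : Fin m → ℕ) : Algebra.FiniteType ℂ (sep o) := by
  have : Algebra.IsIntegral (sep o) (MvPolynomial (Idx o) ℂ) :=
    ⟨fun f => (isIntegral_of_Esub_mem o ⊤ (fun _ _ => trivial) f).tower_top⟩
  have : Algebra.FiniteType (sep o) (MvPolynomial (Idx o) ℂ) :=
    .of_restrictScalars_finiteType ℂ _ _
  have : Module.Finite (sep o) (MvPolynomial (Idx o) ℂ) := Algebra.IsIntegral.finite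
  exact ⟨fg_of_fg_of_fg ℂ (sep o) (MvPolynomial (Idx o) ℂ) Algebra.FiniteType.out
    Module.Finite.fg_top Subtype.val_injective⟩

section

variable {m : ℕ} {o : Fin m → ℕ} {B : Type*} [CommRing B] [Algebra ℂ B] (φ : sep o →ₐ[ℂ] B)
  (A : Subalgebra ℂ B)

/-- If `φ` identifies the alphabet `X_i` with the union of the `X_k`, `k ∈ s`, then the images of
the elementary symmetric polynomials of each `X_k` are integral over those of `X_i`. -/
lemma isIntegral_map_Esub {i : Fin m} {s : Finset (Fin m)} (hi : o i = ∑ k ∈ s, o k)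
    (hA : ∀ a, 1 ≤ a → φ (Esub o {i} a) ∈ A)
    (hφ : ∀ a, 1 ≤ a → φ (Esub o {i} a) = φ (Esub o s a)) {k : Fin m} (hk : k ∈ s) (a : ℕ) :
    IsIntegral A (φ (Esub o {k} a)) := by
  obtain ha | ha := lt_or_ge (∑ l ∈ {k}, o l) a
  · rw [Esub_eq_zero o _ ha, map_zero]
    exact isIntegral_zero
  have hA' : ∀ a, φ (Esub o {i} a) ∈ A := by
    rintro (_ | a)
    · rw [Esub_zero, map_one]
      exact A.one_mem
    · exact hA _ (by omega)
  let p : Polynomial A := descPoly (R := A) (o i) fun a => ⟨_, hA' a⟩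
  have hp : p.Monic := descPoly_monic _ (Subtype.ext (by simp [Esub_zero]))
  have hpmap : p.map (algebraMap A B) = (alphPoly o s).map (φ : sep o →+* B) := by
    rw [alphPoly, descPoly_map, descPoly_map, hi]
    congr 1
    funext a
    change φ (Esub o {i} a) = φ (Esub o s a)
    obtain rfl | ha := Nat.eq_zero_or_pos a
    · simp [Esub_zero]
    · exact hφ a ha
  have hq : ((alphPoly o {k}).map (φ : sep o →+* B)).Monic :=
    (descPoly_monic _ (Esub_zero o _)).map _
  have hdvd : (alphPoly o {k}).map (φ : sep o →+* B) ∣ p.map (algebraMap A B) := by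
    rw [hpmap, ← Finset.insert_erase hk, Finset.insert_eq, alphPoly_union, Polynomial.map_mul]
    · exact dvd_mul_right _ _
    · simp
  have := Polynomial.isIntegral_coeff_of_dvd p _ hp hq hdvd (∑ l ∈ {k}, o l - a)
  rwa [Polynomial.coeff_map, alphPoly, descPoly_coeff ha] at this

/-- A quotient of the separately symmetric polynomials is finite over any subalgebra over which
the images of the elementary symmetric polynomials of the individual alphabets are integral. -/
lemma finite_of_isIntegral_map_Esub (hφ : Function.Surjective φ)
    (h : ∀ l a, IsIntegral A (φ (Esub o {l} a))) : Module.Finite A B := by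
  let K : Subalgebra ℂ (sep o) := ((integralClosure A B).restrictScalars ℂ).comap φ
  have hint : Algebra.IsIntegral A B := by
    refine ⟨fun x => ?_⟩
    obtain ⟨f, rfl⟩ := hφ x
    have hf : IsIntegral K f := IsIntegral.tower_bot (B := MvPolynomial (Idx o) ℂ)
      Subtype.val_injective (isIntegral_of_Esub_mem o K h f)
    let ψ : K →+* integralClosure A B :=
      ((φ : sep o →+* B).comp (algebraMap K (sep o))).codRestrict
        (integralClosure A B) fun y => y.2
    exact isIntegral_trans (A := integralClosure A B) _
      (hf.map_of_comp_eq ψ (φ : sep o →+* B) rfl)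
  have := sep_finiteType o
  have : Algebra.FiniteType ℂ B := .of_surjective φ hφ
  have : Algebra.FiniteType A B := .of_restrictScalars_finiteType ℂ _ _
  exact Algebra.IsIntegral.finite

end

/-- If `φ` satisfies the relations `Y'_1 = W_2 ⊔ W_3` and `W_1 ⊔ W_3 = Y_1` of the crossing web,
then its codomain is finite over the image of the boundary subalgebra. -/
lemma finite_map_adjoin_bdryGens {o : Fin 7 → ℕ} {B : Type*} [CommRing B] [Algebra ℂ B]
    (φ : sep o →ₐ[ℂ] B) (hφ : Function.Surjective φ)
    (h1 : o 2 = o 5 + o 6) (h3 : o 0 = o 4 + o 6)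
    (hφ1 : ∀ a, 1 ≤ a → φ (Esub o {2} a) = φ (Esub o {5, 6} a))
    (hφ3 : ∀ a, 1 ≤ a → φ (Esub o {4, 6} a) = φ (Esub o {0} a)) :
    Module.Finite ((Algebra.adjoin ℂ (bdryGens o)).map φ) B := by
  set A := (Algebra.adjoin ℂ (bdryGens o)).map φ
  have hbdry : ∀ i : Fin 7, (i = 0 ∨ i = 1 ∨ i = 2 ∨ i = 3) → ∀ a, 1 ≤ a →
      φ (Esub o {i} a) ∈ A := fun i hi a ha =>
    Subalgebra.mem_map.mpr ⟨_, Algebra.subset_adjoin ⟨i, hi, a, ha, rfl⟩, rfl⟩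
  refine finite_of_isIntegral_map_Esub φ A hφ fun l a => ?_
  have hY : ∀ i : Fin 7, (i = 0 ∨ i = 1 ∨ i = 2 ∨ i = 3) →
      IsIntegral A (φ (Esub o {i} a)) := fun i hi =>
    isIntegral_map_Esub φ A (i := i) (s := {i}) (by simp) (hbdry i hi) (fun _ _ => rfl)
      (by simp) a
  have hY₁ : ∀ k ∈ ({4, 6} : Finset (Fin 7)), IsIntegral A (φ (Esub o {k} a)) := fun k hk =>
    isIntegral_map_Esub φ A (i := 0) (by simpa using h3) (hbdry 0 (by simp))
      (fun a ha => (hφ3 a ha).symm) hk a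
  have hY'₁ : ∀ k ∈ ({5, 6} : Finset (Fin 7)), IsIntegral A (φ (Esub o {k} a)) := fun k hk =>
    isIntegral_map_Esub φ A (i := 2) (by simpa using h1) (hbdry 2 (by simp)) hφ1 hk a
  fin_cases l
  · exact hY 0 (by simp)
  · exact hY 1 (by simp)
  · exact hY 2 (by simp)
  · exact hY 3 (by simp)
  · exact hY₁ 4 (by simp)
  · exact hY'₁ 5 (by simp)
  · exact hY'₁ 6 (by simp)

/-- With `|Y'_1| = |W_2| + |W_3|`, `|Y'_2| + |W_2| = |Y_2| + |W_1|` and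
`|Y_1| = |W_1| + |W_3|`, the quotient `B = P/J` is a finitely generated module over the image
in `B` of the subalgebra of `P` generated by the elementary symmetric polynomials of the
four boundary alphabets. -/
theorem statement12 (o : Fin 7 → ℕ)
    (h1 : o 2 = o 5 + o 6) (h2 : o 3 + o 5 = o 1 + o 4) (h3 : o 0 = o 4 + o 6) :
    Module.Finite
      ((Algebra.adjoin ℂ (bdryGens o)).map (Ideal.Quotient.mkₐ ℂ (J12 o)))
      ((sep o) ⧸ J12 o) := by
  have hmk : ∀ f g : sep o, f - g ∈ J12 o →
      Ideal.Quotient.mkₐ ℂ (J12 o) f = Ideal.Quotient.mkₐ ℂ (J12 o) g := fun f g =>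
    Ideal.Quotient.eq.mpr
  have := finite_map_adjoin_bdryGens (B := sep o ⧸ J12 o) (Ideal.Quotient.mkₐ ℂ (J12 o))
    (Ideal.Quotient.mkₐ_surjective _ _) h1 h3
    (fun a ha => hmk _ _ (Ideal.subset_span ⟨a, ha, .inl rfl⟩))
    (fun a ha => hmk _ _ (Ideal.subset_span ⟨a, ha, .inr (.inr rfl)⟩))
  exact this
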